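/- For every fixed ω ∈ [0,1], the map m ↦ V_{β,m}(ω) is a convex function of the subsidy m on ℝ. -/

import Mathlib

/-- One-step belief update without observation: `T(ω) = ω·p11 + (1−ω)·p01`. -/
noncomputable def Tmap (p01 p11 ω : ℝ) : ℝ := ω * p11 + (1 - ω) * p01

/-- Belief update after a failed observation: `φ(ω) = εω/(εω + 1 − ω)`. -/
noncomputable def phi (ε ω : ℝ) : ℝ := ε * ω / (ε * ω + 1 - ω)

/-- Active-branch of the Bellman operator: the expected total discounted reward
of activating now and continuing with value function `f`. -/
noncomputable def actV (p01 p11 ε β : ℝ) (f : ℝ → ℝ) (ω : ℝ) : ℝ :=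
  (1 - ε) * ω + β * ((1 - ε) * ω * f p11
    + (1 - (1 - ε) * ω) * f (Tmap p01 p11 (phi ε ω)))

/-- Passive-branch of the Bellman operator: subsidy `m` plus discounted
continuation with value function `f`. -/
noncomputable def pasV (p01 p11 β m : ℝ) (f : ℝ → ℝ) (ω : ℝ) : ℝ :=
  m + β * f (Tmap p01 p11 ω)

/-- The Bellman operator `B` of the single-armed bandit with subsidy `m`. -/
noncomputable def Bop (p01 p11 ε β m : ℝ) (f : ℝ → ℝ) (ω : ℝ) : ℝ :=
  max (actV p01 p11 ε β f ω) (pasV p01 p11 β m f ω)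

/-- The belief update without observation preserves `[0,1]`. -/
lemma Tmap_mem_Icc {p01 p11 ω : ℝ} (hp01 : p01 ∈ Set.Icc (0:ℝ) 1) (hp11 : p11 ∈ Set.Icc (0:ℝ) 1)
    (hω : ω ∈ Set.Icc (0:ℝ) 1) : Tmap p01 p11 ω ∈ Set.Icc (0:ℝ) 1 :=
  (convex_Icc (0:ℝ) 1) hp11 hp01 hω.1 (sub_nonneg.2 hω.2) (add_sub_cancel _ _)

/-- The belief update after a failed observation preserves `[0,1]`. -/
lemma phi_mem_Icc {ε ω : ℝ} (hε : 0 ≤ ε) (hω : ω ∈ Set.Icc (0:ℝ) 1) :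
    phi ε ω ∈ Set.Icc (0:ℝ) 1 := by
  have hnum : 0 ≤ ε * ω := mul_nonneg hε hω.1
  have hle : ε * ω ≤ ε * ω + 1 - ω := by linarith [hω.2]
  exact ⟨div_nonneg hnum (hnum.trans hle), div_le_one_of_le₀ hle (hnum.trans hle)⟩

/-- A function that is bounded above on `s` and whose upper bounds may be shrunk by the factor
`β < 1` is nonpositive on `s`. -/
lemma nonpos_of_upper_bound_contracts {α : Type*} {s : Set α} {g : α → ℝ} {β K : ℝ}
    (hβ0 : 0 ≤ β) (hβ1 : β < 1) (hK : ∀ x ∈ s, g x ≤ K)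
    (hstep : ∀ L, (∀ x ∈ s, g x ≤ L) → ∀ x ∈ s, g x ≤ β * L) : ∀ x ∈ s, g x ≤ 0 := by
  have hpow : ∀ n : ℕ, ∀ x ∈ s, g x ≤ β ^ n * K := by
    intro n
    induction n with
    | zero => simpa using hK
    | succ n ih =>
      intro x hx
      rw [pow_succ', mul_assoc]
      exact hstep _ ih x hx
  intro x hx
  have hlim : Filter.Tendsto (fun n : ℕ => β ^ n * K) Filter.atTop (nhds 0) := by
    simpa using (tendsto_pow_atTop_nhds_zero_of_lt_one hβ0 hβ1).mul_const K
  exact ge_of_tendsto' hlim fun n => hpow n x hx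

/-- The Bellman operator is jointly convex in the subsidy and the continuation value, monotone,
and moves additive constants through with the factor `β`. -/
lemma Bop_le_convex_comb {p01 p11 ε β a b m₁ m₂ L ω : ℝ} {f f₁ f₂ : ℝ → ℝ}
    (hp01 : p01 ∈ Set.Icc (0:ℝ) 1) (hp11 : p11 ∈ Set.Icc (0:ℝ) 1) (hε : ε ∈ Set.Icc (0:ℝ) 1)
    (hβ : 0 ≤ β) (ha : 0 ≤ a) (hb : 0 ≤ b) (hab : a + b = 1)
    (hf : ∀ x ∈ Set.Icc (0:ℝ) 1, f x ≤ a * f₁ x + b * f₂ x + L) (hω : ω ∈ Set.Icc (0:ℝ) 1) :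
    Bop p01 p11 ε β (a * m₁ + b * m₂) f ω ≤
      a * Bop p01 p11 ε β m₁ f₁ ω + b * Bop p01 p11 ε β m₂ f₂ ω + β * L := by
  have hq0 : 0 ≤ (1 - ε) * ω := mul_nonneg (sub_nonneg.2 hε.2) hω.1
  have hq1 : 0 ≤ 1 - (1 - ε) * ω :=
    sub_nonneg.2 (mul_le_one₀ (by linarith [hε.1]) hω.1 hω.2)
  refine max_le ?_ ?_
  · have hact : actV p01 p11 ε β f ω ≤
        a * actV p01 p11 ε β f₁ ω + b * actV p01 p11 ε β f₂ ω + β * L := by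
      have h1 := mul_le_mul_of_nonneg_left (hf p11 hp11) hq0
      have h2 := mul_le_mul_of_nonneg_left
        (hf _ (Tmap_mem_Icc hp01 hp11 (phi_mem_Icc hε.1 hω))) hq1
      have h3 := mul_le_mul_of_nonneg_left (add_le_add h1 h2) hβ
      have hb' : b = 1 - a := by linarith
      subst hb'
      unfold actV
      linarith
    have h1 := mul_le_mul_of_nonneg_left
      (le_max_left (actV p01 p11 ε β f₁ ω) (pasV p01 p11 β m₁ f₁ ω)) ha
    have h2 := mul_le_mul_of_nonneg_left
      (le_max_left (actV p01 p11 ε β f₂ ω) (pasV p01 p11 β m₂ f₂ ω)) hb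
    unfold Bop
    linarith
  · have hpas : pasV p01 p11 β (a * m₁ + b * m₂) f ω ≤
        a * pasV p01 p11 β m₁ f₁ ω + b * pasV p01 p11 β m₂ f₂ ω + β * L := by
      have h := mul_le_mul_of_nonneg_left (hf _ (Tmap_mem_Icc hp01 hp11 hω)) hβ
      unfold pasV
      linarith
    have h1 := mul_le_mul_of_nonneg_left
      (le_max_right (actV p01 p11 ε β f₁ ω) (pasV p01 p11 β m₁ f₁ ω)) ha
    have h2 := mul_le_mul_of_nonneg_left
      (le_max_right (actV p01 p11 ε β f₂ ω) (pasV p01 p11 β m₂ f₂ ω)) hb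
    unfold Bop
    linarith


/-- For every fixed `ω ∈ [0,1]`, the infinite-horizon value `V_{β,m}(ω)` is a
convex function of the subsidy `m` on `ℝ`. -/
theorem V_convexOn_subsidy (p01 p11 ε β : ℝ)
    (hp01 : p01 ∈ Set.Ioo (0:ℝ) 1) (hp11 : p11 ∈ Set.Ioo (0:ℝ) 1)
    (hne : p01 ≠ p11) (hε : ε ∈ Set.Ioo (0:ℝ) 1) (hβ : β ∈ Set.Ioo (0:ℝ) 1)
    (V : ℝ → ℝ → ℝ)
    (hVbdd : ∀ m : ℝ, ∃ C, ∀ ω ∈ Set.Icc (0:ℝ) 1, |V m ω| ≤ C)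
    (hVfix : ∀ m : ℝ, ∀ ω ∈ Set.Icc (0:ℝ) 1, V m ω = Bop p01 p11 ε β m (V m) ω) :
    ∀ ω ∈ Set.Icc (0:ℝ) 1, ConvexOn ℝ Set.univ (fun m : ℝ => V m ω) := by
  intro ω hω
  refine ⟨convex_univ, fun m₁ _ m₂ _ a b ha hb hab => ?_⟩
  simp only [smul_eq_mul]
  obtain ⟨C, hC⟩ := hVbdd (a * m₁ + b * m₂)
  obtain ⟨C₁, hC₁⟩ := hVbdd m₁
  obtain ⟨C₂, hC₂⟩ := hVbdd m₂
  have hgap := nonpos_of_upper_bound_contracts (s := Set.Icc (0:ℝ) 1)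
    (g := fun x => V (a * m₁ + b * m₂) x - (a * V m₁ x + b * V m₂ x))
    (K := C + a * C₁ + b * C₂) hβ.1.le hβ.2
    (fun x hx => by
      have h := (abs_le.1 (hC x hx)).2
      have h1 := mul_le_mul_of_nonneg_left (abs_le.1 (hC₁ x hx)).1 ha
      have h2 := mul_le_mul_of_nonneg_left (abs_le.1 (hC₂ x hx)).1 hb
      linarith)
    (fun L hL x hx => by
      have h := Bop_le_convex_comb (m₁ := m₁) (m₂ := m₂) (Set.Ioo_subset_Icc_self hp01)
        (Set.Ioo_subset_Icc_self hp11) (Set.Ioo_subset_Icc_self hε) hβ.1.le ha hb hab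
        (fun y hy => sub_le_iff_le_add'.1 (hL y hy)) hx
      rw [← hVfix _ x hx, ← hVfix _ x hx, ← hVfix _ x hx] at h
      exact sub_le_iff_le_add'.2 h)
  exact sub_nonpos.1 (hgap ω hω)
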